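/- arXiv:2511.12613 — 3 statements merged into one kernel-verified Lean document; each statement's English description precedes it below -/
import Mathlib

section
/- Let d, r ≥ 1 and for each i = 1,…,d let φ_i : ℝ → ℝ^r be a function that is Lipschitz with constant L_i ≥ 0 (with respect to the Euclidean norm on ℝ^r), and suppose ‖φ_i(x)‖_∞ ≤ M_i for all x ∈ ℝ, with M_i > 0. Define the separable network u : ℝ^d → ℝ by u(x) = ∑_{j=1}^{r} ∏_{i=1}^{d} φ_{i,j}(x_i), where φ_{i,j} denotes the j-th component of φ_i. Then u is Lipschitz (with respect to the Euclidean norm on ℝ^d) with constant at most r · (∏_{i=1}^{d} M_i) · sqrt( ∑_{k=1}^{d} (L_k / M_k)² ). -/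
theorem prod_sub_prod_bound {ι : Type*} [DecidableEq ι] (s : Finset ι) (a b M : ι → ℝ)
    (hM : ∀ i, 0 < M i) (ha : ∀ i, |a i| ≤ M i) (hb : ∀ i, |b i| ≤ M i) :
    |∏ i ∈ s, a i - ∏ i ∈ s, b i| ≤ (∏ i ∈ s, M i) * ∑ k ∈ s, |a k - b k| / M k := by
  induction s using Finset.induction_on with
  | empty => simp
  | insert k s hk ih =>
    rw [Finset.prod_insert hk, Finset.prod_insert hk, Finset.prod_insert hk, Finset.sum_insert hk]
    have hA : |∏ i ∈ s, a i| ≤ ∏ i ∈ s, M i := by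
      rw [Finset.abs_prod]
      exact Finset.prod_le_prod (fun i _ => abs_nonneg _) (fun i _ => ha i)
    have e : a k * ∏ i ∈ s, a i - b k * ∏ i ∈ s, b i
        = (a k - b k) * ∏ i ∈ s, a i + b k * (∏ i ∈ s, a i - ∏ i ∈ s, b i) := by ring
    have e2 : M k * (∏ i ∈ s, M i) * (|a k - b k| / M k + ∑ k ∈ s, |a k - b k| / M k)
        = |a k - b k| * (∏ i ∈ s, M i)
          + M k * ((∏ i ∈ s, M i) * ∑ k ∈ s, |a k - b k| / M k) := by
      have := (hM k).ne'
      field_simp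
    rw [e, e2]
    refine (abs_add_le _ _).trans ?_
    rw [abs_mul, abs_mul]
    exact add_le_add (mul_le_mul_of_nonneg_left hA (abs_nonneg _))
      (mul_le_mul (hb k) ih (abs_nonneg _) (hM k).le)

/-- **General SPINN Lipschitz bound.**
Let `d, r ≥ 1` and for each `i` let `φ i : ℝ → ℝ^r` be Lipschitz with constant `L i ≥ 0`
(Euclidean norm on `ℝ^r`), with `‖φ i x‖_∞ ≤ M i` (i.e. every component is bounded by `M i`),
`M i > 0`.  Then the separable network `u x = ∑ j, ∏ i, (φ i (x i)) j` is Lipschitz (Euclidean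
norm on `ℝ^d`) with constant at most `r * (∏ i, M i) * sqrt (∑ k, (L k / M k)^2)`. -/
theorem general_spinn_lipschitz_bound
    (d r : ℕ) (hd : 1 ≤ d) (hr : 1 ≤ r)
    (φ : Fin d → ℝ → EuclideanSpace ℝ (Fin r))
    (L M : Fin d → ℝ)
    (hL : ∀ i, 0 ≤ L i)
    (hM : ∀ i, 0 < M i)
    (hLip : ∀ i, ∀ a b : ℝ, ‖φ i a - φ i b‖ ≤ L i * |a - b|)
    (hBound : ∀ i, ∀ x : ℝ, ∀ j : Fin r, |φ i x j| ≤ M i)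
    (u : EuclideanSpace ℝ (Fin d) → ℝ)
    (hu : ∀ x, u x = ∑ j : Fin r, ∏ i : Fin d, φ i (x i) j) :
    ∀ x y : EuclideanSpace ℝ (Fin d),
      |u x - u y| ≤
        (r : ℝ) * (∏ i : Fin d, M i) * Real.sqrt (∑ k : Fin d, (L k / M k) ^ 2) * ‖x - y‖ := by
  intro x y
  have hP : 0 ≤ ∏ i : Fin d, M i := Finset.prod_nonneg fun i _ => (hM i).le
  have key : ∀ j : Fin r, |∏ i : Fin d, φ i (x i) j - ∏ i : Fin d, φ i (y i) j| ≤
      (∏ i : Fin d, M i) * (Real.sqrt (∑ k : Fin d, (L k / M k) ^ 2) * ‖x - y‖) := by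
    intro j
    refine (prod_sub_prod_bound Finset.univ (fun i => φ i (x i) j) (fun i => φ i (y i) j) M hM
      (fun i => hBound i _ j) (fun i => hBound i _ j)).trans ?_
    refine mul_le_mul_of_nonneg_left ?_ hP
    have h1 : ∑ k : Fin d, |φ k (x k) j - φ k (y k) j| / M k
        ≤ ∑ k : Fin d, (L k / M k) * |x k - y k| := by
      refine Finset.sum_le_sum fun k _ => ?_
      rw [div_mul_eq_mul_div]
      refine div_le_div_of_nonneg_right ?_ (hM k).le
      refine le_trans ?_ (hLip k (x k) (y k))
      have := PiLp.norm_apply_le (φ k (x k) - φ k (y k)) j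
      simpa using this
    refine h1.trans ((Real.sum_mul_le_sqrt_mul_sqrt _ _ _).trans (le_of_eq ?_))
    rw [EuclideanSpace.norm_eq]
    simp
  rw [hu, hu, ← Finset.sum_sub_distrib]
  refine (Finset.abs_sum_le_sum_abs _ _).trans ((Finset.sum_le_sum fun j _ => key j).trans
    (le_of_eq ?_))
  simp
  ring
end

section
/- Let d, r ≥ 1 and for each k = 1,…,d let φ_k : ℝ → ℝ^r be of the form φ_k = W_k ∘ g_k, where g_k : ℝ → ℝ^r is 1-Lipschitz and W_k : ℝ^r → ℝ^r is a linear map with operator (spectral) norm ‖W_k‖₂. Suppose also that ‖φ_k(x)‖_∞ ≤ M_k for all x ∈ ℝ, with M_k > 0. Define u : ℝ^d → ℝ by u(x) = ∑_{j=1}^{r} ∏_{i=1}^{d} φ_{i,j}(x_i). Then u is Lipschitz (Euclidean norm on ℝ^d) with constant at most r · (∏_{i=1}^{d} M_i) · sqrt( ∑_{k=1}^{d} (‖W_k‖₂ / M_k)² ). -/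
theorem prod_diff_aux {ι : Type*} (s : Finset ι) (a b M : ι → ℝ)
    (hM : ∀ k, 0 < M k) (ha : ∀ k, |a k| ≤ M k) (hb : ∀ k, |b k| ≤ M k) :
    |∏ i ∈ s, a i - ∏ i ∈ s, b i| ≤ (∏ i ∈ s, M i) * ∑ i ∈ s, |a i - b i| / M i := by
  classical
  induction s using Finset.induction_on with
  | empty => simp
  | insert k s hk ih =>
    rw [Finset.prod_insert hk, Finset.prod_insert hk, Finset.prod_insert hk, Finset.sum_insert hk]
    have hpa : |∏ i ∈ s, a i| ≤ ∏ i ∈ s, M i := by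
      rw [Finset.abs_prod]
      exact Finset.prod_le_prod (fun _ _ => abs_nonneg _) (fun i _ => ha i)
    have hMk := hM k
    calc |a k * ∏ i ∈ s, a i - b k * ∏ i ∈ s, b i|
        = |(a k - b k) * ∏ i ∈ s, a i + b k * (∏ i ∈ s, a i - ∏ i ∈ s, b i)| := by
          congr 1; ring
      _ ≤ |a k - b k| * |∏ i ∈ s, a i| + |b k| * |∏ i ∈ s, a i - ∏ i ∈ s, b i| := by
          rw [← abs_mul, ← abs_mul]; exact abs_add_le _ _
      _ ≤ |a k - b k| * (∏ i ∈ s, M i)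
          + M k * ((∏ i ∈ s, M i) * ∑ i ∈ s, |a i - b i| / M i) := by
          have := hb k
          gcongr
      _ = _ := by field_simp

/-- **Refined Lipschitz bound for QO-SPINN.**
Each sub-network `φ k = W k ∘ g k` where `g k : ℝ → ℝ^r` is 1-Lipschitz and `W k` is a linear
map with operator (spectral) norm `‖W k‖`.  If moreover `‖φ k x‖_∞ ≤ M k` with `M k > 0`, then
the separable network `u x = ∑ j, ∏ i, (φ i (x i)) j` is Lipschitz (Euclidean norm on `ℝ^d`)
with constant at most `r * (∏ i, M i) * sqrt (∑ k, (‖W k‖ / M k)^2)`. -/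
theorem qospinn_lipschitz_bound
    (d r : ℕ) (hd : 1 ≤ d) (hr : 1 ≤ r)
    (g : Fin d → ℝ → EuclideanSpace ℝ (Fin r))
    (W : Fin d → (EuclideanSpace ℝ (Fin r) →L[ℝ] EuclideanSpace ℝ (Fin r)))
    (M : Fin d → ℝ)
    (hM : ∀ k, 0 < M k)
    (hg : ∀ k, ∀ a b : ℝ, ‖g k a - g k b‖ ≤ |a - b|)
    (φ : Fin d → ℝ → EuclideanSpace ℝ (Fin r))
    (hφ : ∀ k, ∀ x : ℝ, φ k x = W k (g k x))
    (hBound : ∀ k, ∀ x : ℝ, ∀ j : Fin r, |φ k x j| ≤ M k)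
    (u : EuclideanSpace ℝ (Fin d) → ℝ)
    (hu : ∀ x, u x = ∑ j : Fin r, ∏ i : Fin d, φ i (x i) j) :
    ∀ x y : EuclideanSpace ℝ (Fin d),
      |u x - u y| ≤
        (r : ℝ) * (∏ i : Fin d, M i) * Real.sqrt (∑ k : Fin d, (‖W k‖ / M k) ^ 2) * ‖x - y‖ := by
  intro x y
  have hP : 0 ≤ ∏ i : Fin d, M i := Finset.prod_nonneg fun i _ => (hM i).le
  have hcomp : ∀ (k : Fin d) (j : Fin r), |φ k (x k) j - φ k (y k) j| ≤ ‖W k‖ * |x k - y k| := by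
    intro k j
    have h1 : |φ k (x k) j - φ k (y k) j| ≤ ‖φ k (x k) - φ k (y k)‖ := by
      simpa using PiLp.norm_apply_le (φ k (x k) - φ k (y k)) j
    refine h1.trans ?_
    rw [hφ, hφ, ← map_sub]
    exact ((W k).le_opNorm _).trans (mul_le_mul_of_nonneg_left (hg k _ _) (norm_nonneg _))
  have hterm : ∀ j : Fin r, |∏ i, φ i (x i) j - ∏ i, φ i (y i) j| ≤
      (∏ i, M i) * (Real.sqrt (∑ k : Fin d, (‖W k‖ / M k) ^ 2) * ‖x - y‖) := by
    intro j
    refine (prod_diff_aux Finset.univ (fun i => φ i (x i) j) (fun i => φ i (y i) j) M hM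
      (fun k => hBound k _ j) (fun k => hBound k _ j)).trans ?_
    refine mul_le_mul_of_nonneg_left ?_ hP
    calc ∑ i, |φ i (x i) j - φ i (y i) j| / M i
        ≤ ∑ i, (‖W i‖ / M i) * |x i - y i| := by
          refine Finset.sum_le_sum fun i _ => ?_
          rw [div_mul_eq_mul_div]
          exact div_le_div_of_nonneg_right (hcomp i j) (hM i).le
      _ ≤ Real.sqrt (∑ k : Fin d, (‖W k‖ / M k) ^ 2) * Real.sqrt (∑ k, |x k - y k| ^ 2) :=
          Real.sum_mul_le_sqrt_mul_sqrt _ _ _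
      _ = _ := by
          rw [EuclideanSpace.norm_eq]
          simp
  rw [hu, hu, ← Finset.sum_sub_distrib]
  calc |∑ j : Fin r, (∏ i, φ i (x i) j - ∏ i, φ i (y i) j)|
      ≤ ∑ j : Fin r, |∏ i, φ i (x i) j - ∏ i, φ i (y i) j| := Finset.abs_sum_le_sum_abs _ _
    _ ≤ ∑ _j : Fin r, (∏ i, M i) * (Real.sqrt (∑ k : Fin d, (‖W k‖ / M k) ^ 2) * ‖x - y‖) :=
        Finset.sum_le_sum fun j _ => hterm j
    _ = _ := by
        rw [Finset.sum_const, Finset.card_univ, Fintype.card_fin, nsmul_eq_mul]; ring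
end

section
/- Let c > 0, m ∈ ℝ, and v ∈ ℝ with v² < c². Set β = 1/c² and γ = m / sqrt(1 − β v²). Define T : ℝ × ℝ → ℝ by T(x, t) = 4 · arctan( exp( γ (x − v t) ) ). Then T satisfies the Sine-Gordon equation (1/c²) · ∂²T/∂t² − ∂²T/∂x² + m² · sin(T) = 0 at every point (x, t) ∈ ℝ × ℝ. -/
theorem kink_aux_deriv (a b t : ℝ) :
    deriv (deriv (fun s : ℝ => 4 * Real.arctan (Real.exp (a * s + b)))) t =
      a ^ 2 * (4 * Real.exp (a * t + b) * (1 - Real.exp (a * t + b) ^ 2) /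
        (1 + Real.exp (a * t + b) ^ 2) ^ 2) := by
  have he : ∀ s : ℝ, HasDerivAt (fun s : ℝ => Real.exp (a * s + b))
      (Real.exp (a * s + b) * a) s := by
    intro s
    have h := (((hasDerivAt_id s).const_mul a).add_const b).exp
    simpa using h
  have h1 : deriv (fun s : ℝ => 4 * Real.arctan (Real.exp (a * s + b))) =
      fun s => 4 * (1 / (1 + Real.exp (a * s + b) ^ 2) * (Real.exp (a * s + b) * a)) := by
    funext s
    exact ((he s).arctan.const_mul 4).deriv
  have hne : 1 + Real.exp (a * t + b) ^ 2 ≠ 0 := by positivity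
  have hd := (((((he t).pow 2).const_add 1).inv hne).mul ((he t).mul_const a)).const_mul 4
  rw [h1]
  refine (HasDerivAt.congr_deriv (hd.congr_of_eventuallyEq
    (Filter.Eventually.of_forall fun s => ?_)) ?_).deriv
  · simp
  · simp
    field_simp
    ring

theorem kink_aux_sin (e : ℝ) :
    Real.sin (4 * Real.arctan e) = 4 * e * (1 - e ^ 2) / (1 + e ^ 2) ^ 2 := by
  have hne : 1 + e ^ 2 ≠ 0 := by positivity
  have hc : Real.cos (Real.arctan e) ^ 2 = 1 / (1 + e ^ 2) := Real.cos_sq_arctan e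
  have hs : Real.sin (Real.arctan e) = e * Real.cos (Real.arctan e) := by
    have h := Real.tan_mul_cos (Real.cos_arctan_pos e).ne'
    rw [Real.tan_arctan] at h
    exact h.symm
  have h4 : 4 * Real.arctan e = 2 * (2 * Real.arctan e) := by ring
  rw [h4, Real.sin_two_mul, Real.sin_two_mul, Real.cos_two_mul, hs]
  have : 2 * (2 * (e * Real.cos (Real.arctan e)) * Real.cos (Real.arctan e)) *
      (2 * Real.cos (Real.arctan e) ^ 2 - 1) =
      4 * e * Real.cos (Real.arctan e) ^ 2 * (2 * Real.cos (Real.arctan e) ^ 2 - 1) := by ring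
  rw [this, hc]
  field_simp
  ring

/-- **The kink soliton solves the Sine-Gordon equation.**
Let `c > 0`, `m ∈ ℝ`, `v ∈ ℝ` with `v² < c²`, and set `β = 1/c²`,
`γ = m / sqrt (1 − β v²)`.  Then `T(x, t) = 4 arctan (exp (γ (x − v t)))` satisfies
`(1/c²) ∂²T/∂t² − ∂²T/∂x² + m² sin T = 0` at every point `(x, t)`. -/
theorem kink_soliton_solves_sine_gordon
    (c m v : ℝ) (hc : 0 < c) (hv : v ^ 2 < c ^ 2)
    (β γ : ℝ) (hβ : β = 1 / c ^ 2) (hγ : γ = m / Real.sqrt (1 - β * v ^ 2))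
    (T : ℝ → ℝ → ℝ)
    (hT : ∀ x t : ℝ, T x t = 4 * Real.arctan (Real.exp (γ * (x - v * t)))) :
    ∀ x t : ℝ,
      (1 / c ^ 2) * deriv (deriv (fun s : ℝ => T x s)) t -
        deriv (deriv (fun s : ℝ => T s t)) x +
        m ^ 2 * Real.sin (T x t) = 0 := by
  intro x t
  have hx : (fun s : ℝ => T s t) =
      fun s => 4 * Real.arctan (Real.exp (γ * s + -(γ * v * t))) := by
    funext s
    rw [hT]
    ring_nf
  have ht : (fun s : ℝ => T x s) =
      fun s => 4 * Real.arctan (Real.exp ((-(γ * v)) * s + γ * x)) := by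
    funext s
    rw [hT]
    ring_nf
  rw [hx, ht, kink_aux_deriv, kink_aux_deriv, hT, kink_aux_sin]
  have e1 : γ * x + -(γ * v * t) = γ * (x - v * t) := by ring
  have e2 : -(γ * v) * t + γ * x = γ * (x - v * t) := by ring
  rw [e1, e2, ← hβ]
  have hpos : 0 < 1 - β * v ^ 2 := by
    have h : v ^ 2 / c ^ 2 < 1 := (div_lt_one (by positivity)).2 hv
    have h' : β * v ^ 2 = v ^ 2 / c ^ 2 := by rw [hβ]; ring
    linarith
  have hm : γ ^ 2 * (1 - β * v ^ 2) = m ^ 2 := by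
    rw [hγ, div_pow, Real.sq_sqrt hpos.le]
    field_simp
  rw [← hm]
  ring
end
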